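/- Let k ≥ 4, let B be a finite bipartite simple graph on vertex set V, and let G be the join of B with the complete graph on k−3 vertices. Then G is k-mixing if and only if every proper 3-coloring of B can be transformed into a proper 3-coloring of B using at most 2 distinct colors. -/

import Mathlib

/-- A proper `k`-coloring of `G`: adjacent vertices receive distinct colors. -/
def Proper {V : Type*} (G : SimpleGraph V) (k : ℕ) (c : V → Fin k) : Prop :=
  ∀ ⦃u v : V⦄, G.Adj u v → c u ≠ c v

/-- Two proper `k`-colorings are adjacent if they differ on exactly one vertex. -/
def ColAdj {V : Type*} (G : SimpleGraph V) (k : ℕ) (c c' : V → Fin k) : Prop :=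
  Proper G k c ∧ Proper G k c' ∧ ∃! v, c v ≠ c' v

/-- `c` can be transformed into `c'` via single-vertex recolorings through
proper `k`-colorings. -/
def Reach {V : Type*} (G : SimpleGraph V) (k : ℕ) : (V → Fin k) → (V → Fin k) → Prop :=
  Relation.ReflTransGen (ColAdj G k)

/-- `G` is `k`-mixing: any proper `k`-coloring can be transformed into any other. -/
def Mixing {V : Type*} (G : SimpleGraph V) (k : ℕ) : Prop :=
  ∀ c c' : V → Fin k, Proper G k c → Proper G k c' → Reach G k c c'

/-- `G` is bipartite: it admits a proper `2`-coloring. -/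
def Bipartite {V : Type*} (G : SimpleGraph V) : Prop :=
  ∃ c : V → Fin 2, Proper G 2 c

/-- The join of `B` with the complete graph on `m` vertices. -/
def JoinK {V : Type*} (B : SimpleGraph V) (m : ℕ) : SimpleGraph (V ⊕ Fin m) :=
  SimpleGraph.fromRel fun x y =>
    match x, y with
    | Sum.inl u, Sum.inl v => B.Adj u v
    | Sum.inl _, Sum.inr _ => True
    | Sum.inr _, Sum.inl _ => True
    | Sum.inr i, Sum.inr j => i ≠ j

section Recoloring

variable {V : Type*} {G : SimpleGraph V} {k : ℕ}

theorem ColAdj.symm {c c' : V → Fin k} (h : ColAdj G k c c') : ColAdj G k c' c := by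
  obtain ⟨h₁, h₂, h₃⟩ := h
  exact ⟨h₂, h₁, by simpa only [ne_comm] using h₃⟩

theorem Reach.symm {c c' : V → Fin k} (h : Reach G k c c') : Reach G k c' c :=
  have : Std.Symm (ColAdj G k) := ⟨fun _ _ => ColAdj.symm⟩
  symm_of (Relation.ReflTransGen (ColAdj G k)) h

/-- Two proper colorings that differ on an independent set can be transformed into each other. -/
theorem Reach.of_indep_diff [Fintype V] {c c' : V → Fin k} (hc : Proper G k c)
    (hc' : Proper G k c') (hind : ∀ u v, G.Adj u v → c u ≠ c' u → c v = c' v) :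
    Reach G k c c' := by
  classical
  induction hn : (Finset.univ.filter fun v => c v ≠ c' v).card generalizing c with
  | zero =>
    have : c = c' := by
      ext1 v
      simpa using Finset.filter_eq_empty_iff.mp (Finset.card_eq_zero.mp hn) (Finset.mem_univ v)
    exact this ▸ Relation.ReflTransGen.refl
  | succ n ih =>
    obtain ⟨v, hv⟩ := Finset.card_pos.mp (n.succ_pos.trans_eq hn.symm)
    have hvc : c v ≠ c' v := (Finset.mem_filter.mp hv).2
    have hd : Proper G k (Function.update c v (c' v)) := by
      intro a b hab
      have h₁ := hind a b hab
      have h₂ := hind b a hab.symm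
      have h₃ := hc hab
      have h₄ := hc' hab
      simp only [Function.update_apply]
      grind
    refine Relation.ReflTransGen.head (b := Function.update c v (c' v))
      ⟨hc, hd, v, by simpa using hvc, ?_⟩ (ih hd ?_ ?_)
    · intro w hw
      by_contra h
      simp [h] at hw
    · intro a b hab
      have h₁ := hind a b hab
      simp only [Function.update_apply]
      grind
    · have : (Finset.univ.filter fun w => Function.update c v (c' v) w ≠ c' w) =
          (Finset.univ.filter fun w => c w ≠ c' w).erase v := by
        ext w
        by_cases h : w = v <;> simp [h]
      rw [this, Finset.card_erase_of_mem hv, hn, Nat.add_sub_cancel]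

/-- With a spare color, the colorings obtained from a fixed proper labelling by injectively
assigning colors to labels can be transformed into each other. -/
theorem Reach.comp_of_injective [Fintype V] {α : Type*} [Fintype α] (hα : Fintype.card α < k)
    {h : V → α} (hh : ∀ ⦃u v⦄, G.Adj u v → h u ≠ h v) {s t : α → Fin k}
    (hs : s.Injective) (ht : t.Injective) : Reach G k (s ∘ h) (t ∘ h) := by
  classical
  have key : ∀ {s : α → Fin k}, s.Injective → ∀ x f, (∀ y, s y ≠ f) →
      (Function.update s x f).Injective ∧
        Reach G k (s ∘ h) (Function.update s x f ∘ h) := by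
    intro s hs x f hf
    have hinj : (Function.update s x f).Injective := by
      intro a b hab
      have := @hs a b
      simp only [Function.update_apply] at hab
      grind
    refine ⟨hinj, Reach.of_indep_diff (fun u v huv => hs.ne (hh huv))
      (fun u v huv => hinj.ne (hh huv)) ?_⟩
    intro u v huv
    have := hh huv
    simp only [Function.comp_apply, Function.update_apply]
    grind
  induction hn : (Finset.univ.filter fun x => s x ≠ t x).card using Nat.strong_induction_on
    generalizing s with
  | _ n ih =>
  by_cases hst : s = t
  · exact hst ▸ Relation.ReflTransGen.refl
  obtain ⟨x, hx⟩ := Function.ne_iff.mp hst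
  have step : ∀ {s' : α → Fin k}, s'.Injective → (∀ y, s' y ≠ t x) →
      (∀ y, s y = t y → s' y = t y) → Reach G k (s ∘ h) (s' ∘ h) →
      Reach G k (s ∘ h) (t ∘ h) := by
    intro s' hs' hfree hle hr
    obtain ⟨h₁, h₂⟩ := key hs' x (t x) hfree
    refine (hr.trans h₂).trans (ih _ ?_ h₁ rfl)
    rw [← hn]
    refine Finset.card_lt_card (Finset.ssubset_iff_of_subset ?_ |>.mpr ⟨x, by simpa, by simp⟩)
    intro y
    have := hle y
    simp only [Finset.mem_filter_univ, Function.update_apply]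
    grind
  by_cases hy : ∃ y, s y = t x
  · obtain ⟨y, hy⟩ := hy
    obtain ⟨f, hf⟩ : ∃ f, ∀ z, s z ≠ f := by
      by_contra! hsurj
      have := Fintype.card_le_of_surjective s hsurj
      simp at this
      omega
    obtain ⟨h₁, h₂⟩ := key hs y f hf
    refine step h₁ (fun z => ?_) (fun z hz => ?_) h₂
    · have := @hs z y
      have := hf y
      simp only [Function.update_apply]
      grind
    · have := @ht x z
      simp only [Function.update_apply]
      grind
  · exact step hs (not_exists.mp hy) (fun _ => id) Relation.ReflTransGen.refl

/-- If one of three colors is unused, a proper coloring can be transformed into any proper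
coloring that uses only the other two colors. -/
theorem Reach.of_missing_color [Fintype V] {c c' : V → Fin 3} {z : Fin 3}
    (hc : Proper G 3 c) (hc' : Proper G 3 c') (hz : ∀ v, c v ≠ z) (hz' : ∀ v, c' v ≠ z) :
    Reach G 3 c c' := by
  obtain ⟨a, b, hab, haz, hbz, hall⟩ : ∃ a b : Fin 3, a ≠ b ∧ a ≠ z ∧ b ≠ z ∧
      ∀ x, x = a ∨ x = b ∨ x = z := by
    clear hz hz'
    revert z
    decide
  have hcv : ∀ v, c v = a ∨ c v = b := fun v => by grind
  have hcv' : ∀ v, c' v = a ∨ c' v = b := fun v => by grind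
  let d₁ : V → Fin 3 := fun v => if c v = a ∧ c' v = b then z else c v
  let d₂ : V → Fin 3 := fun v => if c v = a ∧ c' v = b then z else c' v
  have h₁ : Proper G 3 d₁ := by
    intro u v huv
    grind [hc huv, hc' huv]
  have h₂ : Proper G 3 d₂ := by
    intro u v huv
    grind [hc huv, hc' huv]
  refine ((Reach.of_indep_diff hc h₁ ?_).trans (Reach.of_indep_diff h₁ h₂ ?_)).trans
    (Reach.of_indep_diff h₂ hc' ?_)
  all_goals
    intro u v huv
    grind [hc huv, hc' huv]

end Recoloring

section Join

variable {V : Type*} {B : SimpleGraph V} {m k : ℕ}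

@[simp]
theorem joinK_adj_inl_inl {u v : V} : (JoinK B m).Adj (.inl u) (.inl v) ↔ B.Adj u v := by
  simp only [JoinK, SimpleGraph.fromRel_adj, B.adj_comm v u, or_self, and_iff_right_iff_imp]
  exact fun h => Sum.inl_injective.ne h.ne

@[simp]
theorem joinK_adj_inl_inr {u : V} {i : Fin m} : (JoinK B m).Adj (.inl u) (.inr i) := by
  simp [JoinK]

@[simp]
theorem joinK_adj_inr_inl {u : V} {i : Fin m} : (JoinK B m).Adj (.inr i) (.inl u) := by
  simp [JoinK]

@[simp]
theorem joinK_adj_inr_inr {i j : Fin m} : (JoinK B m).Adj (.inr i) (.inr j) ↔ i ≠ j := by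
  simp [JoinK, eq_comm]

theorem joinK_map_ne {α : Type*} {c : V → α} (hc : ∀ ⦃u v⦄, B.Adj u v → c u ≠ c v)
    ⦃x y : V ⊕ Fin m⦄ (hxy : (JoinK B m).Adj x y) : Sum.map c id x ≠ Sum.map c id y := by
  rcases x with u | i <;> rcases y with v | j
  · simpa using hc (joinK_adj_inl_inl.mp hxy)
  · simp
  · simp
  · simpa using hxy

theorem proper_joinK_iff {E : Fin 3 ⊕ Fin m → Fin k} (hE : E.Injective) {c : V → Fin 3} :
    Proper (JoinK B m) k (E ∘ Sum.map c id) ↔ Proper B 3 c := by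
  refine ⟨fun h u v huv hcuv => h (joinK_adj_inl_inl.mpr huv) (by simp [hcuv]),
    fun h x y hxy => hE.ne (joinK_map_ne h hxy)⟩

theorem colAdj_joinK_iff {E : Fin 3 ⊕ Fin m → Fin k} (hE : E.Injective) {c c' : V → Fin 3} :
    ColAdj (JoinK B m) k (E ∘ Sum.map c id) (E ∘ Sum.map c' id) ↔ ColAdj B 3 c c' := by
  simp only [ColAdj, proper_joinK_iff hE]
  refine and_congr_right fun _ => and_congr_right fun _ => ⟨?_, ?_⟩
  · rintro ⟨v | i, hv, huniq⟩
    · refine ⟨v, fun h => hv (by simp [h]), fun w hw => ?_⟩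
      exact Sum.inl_injective (huniq (.inl w) (hE.ne (by simpa using hw)))
    · simp at hv
  · rintro ⟨v, hv, huniq⟩
    refine ⟨.inl v, hE.ne (by simpa using hv), ?_⟩
    rintro (w | i) hw
    · exact congrArg _ (huniq w fun h => hw (by simp [h]))
    · simp at hw

theorem Reach.joinK {E : Fin 3 ⊕ Fin m → Fin k} (hE : E.Injective) {c c' : V → Fin 3}
    (h : Reach B 3 c c') :
    Reach (JoinK B m) k (E ∘ Sum.map c id) (E ∘ Sum.map c' id) :=
  Relation.ReflTransGen.lift (fun c : V → Fin 3 => E ∘ Sum.map c id)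
    (fun _ _ h => (colAdj_joinK_iff hE).mpr h) _ _ h

/-- While the coloring of `B` uses all three of its colors, the clique cannot be recolored. -/
theorem ColAdj.exists_eq_of_surjective {E : Fin 3 ⊕ Fin m → Fin k} (hE : E.Bijective)
    {c : V → Fin 3} (hc : c.Surjective) {z : V ⊕ Fin m → Fin k}
    (h : ColAdj (JoinK B m) k (E ∘ Sum.map c id) z) :
    ∃ c' : V → Fin 3, z = E ∘ Sum.map c' id := by
  obtain ⟨-, hz, w, -, huniq⟩ := h
  have hagree : ∀ x, x ≠ w → z x = E (Sum.map c id x) := fun x hx => by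
    by_contra h
    exact hx (huniq x (Ne.symm h))
  have hinr : ∀ i, z (.inr i) = E (.inr i) := by
    intro i
    by_cases hi : Sum.inr i = w
    · obtain ⟨x | j, hx⟩ := hE.surjective (z (.inr i))
      · obtain ⟨v, rfl⟩ := hc x
        refine absurd ?_ (hz (joinK_adj_inl_inr (u := v) (i := i)))
        rw [hagree _ (by simp [← hi]), ← hx, Sum.map_inl]
      · by_cases hij : i = j
        · rw [← hx, hij]
        · refine absurd ?_ (hz (joinK_adj_inr_inr.mpr hij))
          rw [hagree (.inr j) (by simp [← hi, Ne.symm hij]), ← hx, Sum.map_inr, id]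
    · exact hagree _ hi
  have hinl : ∀ v, ∃ x, z (.inl v) = E (.inl x) := by
    intro v
    obtain ⟨x | j, hx⟩ := hE.surjective (z (.inl v))
    · exact ⟨x, hx.symm⟩
    · exact absurd (hx.symm.trans (hinr j).symm) (hz joinK_adj_inl_inr)
  choose c' hc' using hinl
  refine ⟨c', funext ?_⟩
  rintro (v | i)
  · exact hc' v
  · exact hinr i

theorem surjective_of_two_lt_ncard_range {c : V → Fin 3} (hc : ¬ (Set.range c).ncard ≤ 2) :
    c.Surjective := by
  rw [← Set.range_eq_univ]
  refine Set.eq_of_subset_of_ncard_le (Set.subset_univ _) ?_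
  rw [Set.ncard_univ, Nat.card_eq_fintype_card, Fintype.card_fin]
  omega

theorem exists_ncard_range_le_two_or_eq {E : Fin 3 ⊕ Fin m → Fin k} (hE : E.Bijective)
    {c : V → Fin 3} {y : V ⊕ Fin m → Fin k}
    (h : Reach (JoinK B m) k (E ∘ Sum.map c id) y) :
    (∃ c', Reach B 3 c c' ∧ (Set.range c').ncard ≤ 2) ∨
      ∃ c', Reach B 3 c c' ∧ y = E ∘ Sum.map c' id := by
  induction h with
  | refl => exact .inr ⟨c, .refl, rfl⟩
  | tail _ hstep ih =>
    rcases ih with ih | ⟨c', hr, rfl⟩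
    · exact .inl ih
    by_cases hcard : (Set.range c').ncard ≤ 2
    · exact .inl ⟨c', hr, hcard⟩
    obtain ⟨c'', rfl⟩ := hstep.exists_eq_of_surjective hE (surjective_of_two_lt_ncard_range hcard)
    exact .inr ⟨c'', hr.tail ((colAdj_joinK_iff hE.injective).mp hstep), rfl⟩

theorem exists_eq_comp_map_of_proper {φ : V ⊕ Fin m → Fin (m + 3)}
    (hφ : Proper (JoinK B m) (m + 3) φ) :
    ∃ E : Fin 3 ⊕ Fin m → Fin (m + 3), E.Injective ∧
      ∃ c : V → Fin 3, φ = E ∘ Sum.map c id := by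
  classical
  have hψ : (fun i => φ (.inr i)).Injective := fun i j hij => by
    by_contra h
    exact hφ (joinK_adj_inr_inr.mpr h) hij
  let A : Finset (Fin (m + 3)) := (Finset.univ.image fun i => φ (.inr i))ᶜ
  have hA : A.card = 3 := by
    rw [Finset.card_compl, Finset.card_image_of_injective _ hψ]
    simp
  let e := A.equivFinOfCardEq hA
  have hmem : ∀ x, x ∈ A ↔ ∀ i, φ (.inr i) ≠ x := fun x => by simp [A]
  refine ⟨Sum.elim (fun x => e.symm x) fun i => φ (.inr i),
    (Subtype.val_injective.comp e.symm.injective).sumElim hψ fun x i h =>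
      (hmem _).mp (e.symm x).2 i h.symm,
    fun v => e ⟨φ (.inl v), (hmem _).mpr fun i => hφ joinK_adj_inr_inl⟩, funext ?_⟩
  rintro (v | i) <;> simp

theorem exists_reach_comp_map [Fintype V] {β : V → Fin 2} (hβ : Proper B 2 β)
    (H : ∀ c : V → Fin 3, Proper B 3 c →
      ∃ c' : V → Fin 3, Reach B 3 c c' ∧ (Set.range c').ncard ≤ 2)
    {φ : V ⊕ Fin m → Fin (m + 3)} (hφ : Proper (JoinK B m) (m + 3) φ) :
    ∃ s : Fin 2 ⊕ Fin m → Fin (m + 3), s.Injective ∧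
      Reach (JoinK B m) (m + 3) φ (s ∘ Sum.map β id) := by
  obtain ⟨E, hE, c, rfl⟩ := exists_eq_comp_map_of_proper hφ
  have hc := (proper_joinK_iff hE).mp hφ
  obtain ⟨c', hcc', hcard⟩ := H c hc
  have hc' : Proper B 3 c' := by
    rcases Relation.ReflTransGen.cases_tail hcc' with rfl | ⟨_, _, h⟩
    · exact hc
    · exact h.2.1
  obtain ⟨z, hz⟩ : ∃ z, ∀ v, c' v ≠ z := by
    by_contra! hsurj
    rw [Set.range_eq_univ.mpr hsurj, Set.ncard_univ, Nat.card_eq_fintype_card,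
      Fintype.card_fin] at hcard
    omega
  have hr : Reach B 3 c' (z.succAbove ∘ β) :=
    Reach.of_missing_color hc' (fun u v huv => Fin.succAbove_right_injective.ne (hβ huv)) hz
      fun v => Fin.succAbove_ne z _
  refine ⟨E ∘ Sum.map z.succAbove id,
    hE.comp (Fin.succAbove_right_injective.sumMap Function.injective_id), ?_⟩
  have := Reach.joinK hE (hcc'.trans hr)
  rwa [Function.comp_assoc, Sum.map_comp_map]

end Join

/-- for `k ≥ 4` and bipartite `B`, the join of `B` with `K_{k-3}` is
`k`-mixing iff every proper `3`-coloring of `B` can be transformed into one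
using at most `2` colors. -/
theorem stmt4 {V : Type*} [Fintype V] (k : ℕ) (hk : 4 ≤ k)
    (B : SimpleGraph V) (hbip : Bipartite B) :
    Mixing (JoinK B (k - 3)) k ↔
      (∀ c : V → Fin 3, Proper B 3 c →
        ∃ c' : V → Fin 3, Reach B 3 c c' ∧ (Set.range c').ncard ≤ 2) := by
  obtain ⟨m, rfl⟩ : ∃ m, k = m + 3 := ⟨k - 3, by omega⟩
  rw [Nat.add_sub_cancel]
  obtain ⟨β, hβ⟩ := hbip
  constructor
  · intro hmix c hc
    let E : Fin 3 ⊕ Fin m ≃ Fin (m + 3) := Fintype.equivOfCardEq (by simp [add_comm])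
    let t : V → Fin 3 := Fin.castSucc ∘ β
    have ht : Proper B 3 t := fun u v huv => (Fin.castSucc_injective 2).ne (hβ huv)
    have ht2 : (Set.range t).ncard ≤ 2 := by
      refine (Set.ncard_le_ncard (Set.range_comp_subset_range β Fin.castSucc)).trans ?_
      rw [← Set.image_univ]
      exact (Set.ncard_image_le).trans (by simp)
    rcases exists_ncard_range_le_two_or_eq E.bijective
      (hmix _ _ ((proper_joinK_iff E.injective).mpr hc)
        ((proper_joinK_iff E.injective).mpr ht)) with h | ⟨c', hr, heq⟩
    · exact h
    · have : t = c' := funext fun v => by simpa using congrFun heq (.inl v)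
      exact ⟨c', hr, this ▸ ht2⟩
  · intro H φ φ' hφ hφ'
    obtain ⟨s, hs, hr⟩ := exists_reach_comp_map hβ H hφ
    obtain ⟨s', hs', hr'⟩ := exists_reach_comp_map hβ H hφ'
    exact (hr.trans (Reach.comp_of_injective (by simp; omega) (joinK_map_ne hβ) hs hs')).trans
      hr'.symm
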